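/- arXiv:2211.10757 — 2 statements merged into one kernel-verified Lean document; each statement's English description precedes it below -/
import Mathlib

section
/- Let Ω ⊂ ℝ³ be open, let Ψ, α, β : Ω → ℝ be twice continuously differentiable with ∇Ψ·∇α = 0 and ∇Ψ·∇β = 0 on Ω, and let f = f(Ψ,α) and g = g(Ψ,β) be continuously differentiable functions of two real variables. Then the vector field w = f(Ψ,α)∇α + g(Ψ,β)∇β satisfies (∇×w)×w = λ∇Ψ, where λ = −(1/2)(∂f²/∂Ψ)|∇α|² − (1/2)(∂g²/∂Ψ)|∇β|² − (∂(fg)/∂Ψ) ∇α·∇β; in particular [(∇×w)×w]×∇Ψ = 0 on Ω. -/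
/-- Partial derivative of a scalar field on `ℝ³` in the `i`-th coordinate direction. -/
noncomputable def pd (i : Fin 3) (f : (Fin 3 → ℝ) → ℝ) (x : Fin 3 → ℝ) : ℝ :=
  fderiv ℝ f x (Pi.single i 1)

/-- Gradient of a scalar field on `ℝ³`. -/
noncomputable def grad (f : (Fin 3 → ℝ) → ℝ) (x : Fin 3 → ℝ) : Fin 3 → ℝ :=
  ![pd 0 f x, pd 1 f x, pd 2 f x]

/-- Divergence of a vector field on `ℝ³`. -/
noncomputable def div3 (w : (Fin 3 → ℝ) → (Fin 3 → ℝ)) (x : Fin 3 → ℝ) : ℝ :=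
  pd 0 (fun y => w y 0) x + pd 1 (fun y => w y 1) x + pd 2 (fun y => w y 2) x

/-- Curl of a vector field on `ℝ³`. -/
noncomputable def curl (w : (Fin 3 → ℝ) → (Fin 3 → ℝ)) (x : Fin 3 → ℝ) : Fin 3 → ℝ :=
  ![pd 1 (fun y => w y 2) x - pd 2 (fun y => w y 1) x,
    pd 2 (fun y => w y 0) x - pd 0 (fun y => w y 2) x,
    pd 0 (fun y => w y 1) x - pd 1 (fun y => w y 0) x]

/-- Cross product on `ℝ³`. -/
def cross3 (u v : Fin 3 → ℝ) : Fin 3 → ℝ :=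
  ![u 1 * v 2 - u 2 * v 1, u 2 * v 0 - u 0 * v 2, u 0 * v 1 - u 1 * v 0]

/-- Dot product on `ℝ³`. -/
def dot3 (u v : Fin 3 → ℝ) : ℝ := u 0 * v 0 + u 1 * v 1 + u 2 * v 2

theorem grad_apply (f : (Fin 3 → ℝ) → ℝ) (x : Fin 3 → ℝ) (i : Fin 3) :
    grad f x i = pd i f x := by
  fin_cases i <;> rfl

theorem differentiableAt_pd {a : (Fin 3 → ℝ) → ℝ} {x : Fin 3 → ℝ}
    (ha : ContDiffAt ℝ 2 a x) (i : Fin 3) : DifferentiableAt ℝ (pd i a) x :=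
  ((ha.fderiv_right (m := 1) le_rfl).differentiableAt one_ne_zero).clm_apply
    (differentiableAt_const _)

theorem pd_comm {a : (Fin 3 → ℝ) → ℝ} {x : Fin 3 → ℝ}
    (ha : ContDiffAt ℝ 2 a x) (i j : Fin 3) : pd i (pd j a) x = pd j (pd i a) x := by
  have hd : DifferentiableAt ℝ (fderiv ℝ a) x :=
    (ha.fderiv_right (m := 1) le_rfl).differentiableAt one_ne_zero
  have key (k l : Fin 3) : pd k (pd l a) x =
      fderiv ℝ (fderiv ℝ a) x (Pi.single k 1) (Pi.single l 1) := by
    change fderiv ℝ (fun y => fderiv ℝ a y (Pi.single l 1)) x _ = _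
    rw [fderiv_clm_apply hd (differentiableAt_const _)]
    simp
  rw [key, key]
  exact (ha.isSymmSndFDerivAt (by simp)).eq _ _

theorem pd_comp_prodMk {f : ℝ × ℝ → ℝ} {u v : (Fin 3 → ℝ) → ℝ} {x : Fin 3 → ℝ}
    (hf : DifferentiableAt ℝ f (u x, v x)) (hu : DifferentiableAt ℝ u x)
    (hv : DifferentiableAt ℝ v x) (i : Fin 3) :
    pd i (fun y => f (u y, v y)) x =
      fderiv ℝ f (u x, v x) (1, 0) * pd i u x + fderiv ℝ f (u x, v x) (0, 1) * pd i v x := by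
  have h := hf.hasFDerivAt.comp x (hu.hasFDerivAt.prodMk hv.hasFDerivAt)
  have h' : pd i (fun y => f (u y, v y)) x =
      fderiv ℝ f (u x, v x) (pd i u x, pd i v x) :=
    congrArg (fun L => L (Pi.single i 1)) h.fderiv
  have hp : ((pd i u x, pd i v x) : ℝ × ℝ) =
      pd i u x • ((1, 0) : ℝ × ℝ) + pd i v x • ((0, 1) : ℝ × ℝ) := by simp
  rw [h', hp, map_add, map_smul, map_smul, smul_eq_mul, smul_eq_mul]
  ring

theorem pd_add {u v : (Fin 3 → ℝ) → ℝ} {x : Fin 3 → ℝ}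
    (hu : DifferentiableAt ℝ u x) (hv : DifferentiableAt ℝ v x) (i : Fin 3) :
    pd i (fun y => u y + v y) x = pd i u x + pd i v x := by
  unfold pd
  rw [fderiv_fun_add hu hv]
  rfl

theorem pd_mul {u v : (Fin 3 → ℝ) → ℝ} {x : Fin 3 → ℝ}
    (hu : DifferentiableAt ℝ u x) (hv : DifferentiableAt ℝ v x) (i : Fin 3) :
    pd i (fun y => u y * v y) x = pd i u x * v x + u x * pd i v x := by
  unfold pd
  rw [fderiv_fun_mul hu hv]
  simp
  ring

theorem curl_smul_grad_add_smul_grad {F G a b : (Fin 3 → ℝ) → ℝ} {x : Fin 3 → ℝ}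
    (hF : DifferentiableAt ℝ F x) (hG : DifferentiableAt ℝ G x)
    (ha : ContDiffAt ℝ 2 a x) (hb : ContDiffAt ℝ 2 b x) :
    curl (fun y => F y • grad a y + G y • grad b y) x =
      cross3 (grad F x) (grad a x) + cross3 (grad G x) (grad b x) := by
  have key (i j : Fin 3) :
      pd i (fun y => (F y • grad a y + G y • grad b y) j) x =
        pd i F x * pd j a x + F x * pd i (pd j a) x +
          (pd i G x * pd j b x + G x * pd i (pd j b) x) := by
    simp only [Pi.add_apply, Pi.smul_apply, smul_eq_mul, grad_apply]
    rw [pd_add (hF.fun_mul (differentiableAt_pd ha j)) (hG.fun_mul (differentiableAt_pd hb j)),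
      pd_mul hF (differentiableAt_pd ha j), pd_mul hG (differentiableAt_pd hb j)]
  unfold curl
  simp only [key]
  rw [pd_comm ha 2 1, pd_comm ha 2 0, pd_comm ha 1 0,
    pd_comm hb 2 1, pd_comm hb 2 0, pd_comm hb 1 0]
  ext k
  fin_cases k <;> simp [cross3, grad_apply] <;> ring

theorem cross3_cross3 (u v w : Fin 3 → ℝ) :
    cross3 (cross3 u v) w = dot3 u w • v - dot3 v w • u := by
  ext k
  fin_cases k <;> simp [cross3, dot3] <;> ring

theorem cross3_add_left (u v w : Fin 3 → ℝ) :
    cross3 (u + v) w = cross3 u w + cross3 v w := by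
  ext k
  fin_cases k <;> simp [cross3] <;> ring

theorem cross3_smul_self (c : ℝ) (u : Fin 3 → ℝ) : cross3 (c • u) u = 0 := by
  ext k
  fin_cases k <;> simp [cross3] <;> ring

theorem cross3_grad_comp_prodMk {f : ℝ × ℝ → ℝ} {u v : (Fin 3 → ℝ) → ℝ} {x : Fin 3 → ℝ}
    (hf : DifferentiableAt ℝ f (u x, v x)) (hu : DifferentiableAt ℝ u x)
    (hv : DifferentiableAt ℝ v x) :
    cross3 (grad (fun y => f (u y, v y)) x) (grad v x) =
      cross3 (fderiv ℝ f (u x, v x) (1, 0) • grad u x) (grad v x) := by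
  ext k
  fin_cases k <;> simp [cross3, grad_apply, pd_comp_prodMk hf hu hv] <;> ring

theorem fderiv_sq_apply {f : ℝ × ℝ → ℝ} {p : ℝ × ℝ} (hf : DifferentiableAt ℝ f p)
    (v : ℝ × ℝ) : fderiv ℝ (fun q => f q ^ 2) p v = 2 * f p * fderiv ℝ f p v := by
  rw [fderiv_fun_pow 2 hf]
  simp

/-- if `∇Ψ·∇α = ∇Ψ·∇β = 0`, then `w = f(Ψ,α)∇α + g(Ψ,β)∇β` satisfies
`(∇×w)×w = λ∇Ψ` with
`λ = −(1/2)(∂f²/∂Ψ)|∇α|² − (1/2)(∂g²/∂Ψ)|∇β|² − (∂(fg)/∂Ψ)∇α·∇β`,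
so in particular `[(∇×w)×w]×∇Ψ = 0`. -/
theorem two_potential_foliated_field
    (Ω : Set (Fin 3 → ℝ)) (hΩ : IsOpen Ω)
    (Ψ α β : (Fin 3 → ℝ) → ℝ)
    (hΨ : ContDiffOn ℝ 2 Ψ Ω) (hα : ContDiffOn ℝ 2 α Ω) (hβ : ContDiffOn ℝ 2 β Ω)
    (hoα : ∀ x ∈ Ω, dot3 (grad Ψ x) (grad α x) = 0)
    (hoβ : ∀ x ∈ Ω, dot3 (grad Ψ x) (grad β x) = 0)
    (f g : ℝ × ℝ → ℝ) (hf : ContDiff ℝ 1 f) (hg : ContDiff ℝ 1 g)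
    (w : (Fin 3 → ℝ) → (Fin 3 → ℝ))
    (hw : ∀ x, w x = f (Ψ x, α x) • grad α x + g (Ψ x, β x) • grad β x)
    (lam : (Fin 3 → ℝ) → ℝ)
    (hlam : ∀ x, lam x =
      -(1/2) * fderiv ℝ (fun q : ℝ × ℝ => f q ^ 2) (Ψ x, α x) (1, 0) *
          dot3 (grad α x) (grad α x)
      - (1/2) * fderiv ℝ (fun q : ℝ × ℝ => g q ^ 2) (Ψ x, β x) (1, 0) *
          dot3 (grad β x) (grad β x)
      - (fderiv ℝ f (Ψ x, α x) (1, 0) * g (Ψ x, β x) +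
          f (Ψ x, α x) * fderiv ℝ g (Ψ x, β x) (1, 0)) *
          dot3 (grad α x) (grad β x)) :
    (∀ x ∈ Ω, cross3 (curl w x) (w x) = lam x • grad Ψ x) ∧
    (∀ x ∈ Ω, cross3 (cross3 (curl w x) (w x)) (grad Ψ x) = 0) := by
  have main : ∀ x ∈ Ω, cross3 (curl w x) (w x) = lam x • grad Ψ x := by
    intro x hx
    have hΨx := hΨ.contDiffAt (hΩ.mem_nhds hx)
    have hαx := hα.contDiffAt (hΩ.mem_nhds hx)
    have hβx := hβ.contDiffAt (hΩ.mem_nhds hx)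
    have dΨ := hΨx.differentiableAt two_ne_zero
    have dα := hαx.differentiableAt two_ne_zero
    have dβ := hβx.differentiableAt two_ne_zero
    have df : DifferentiableAt ℝ f (Ψ x, α x) := hf.differentiable one_ne_zero _
    have dg : DifferentiableAt ℝ g (Ψ x, β x) := hg.differentiable one_ne_zero _
    have dF : DifferentiableAt ℝ (fun y => f (Ψ y, α y)) x := df.comp x (dΨ.prodMk dα)
    have dG : DifferentiableAt ℝ (fun y => g (Ψ y, β y)) x := dg.comp x (dΨ.prodMk dβ)
    have hα0 := hoα x hx
    have hβ0 := hoβ x hx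
    rw [hlam x, fderiv_sq_apply df, fderiv_sq_apply dg, hw x, funext hw,
      curl_smul_grad_add_smul_grad dF dG hαx hβx, cross3_grad_comp_prodMk df dΨ dα,
      cross3_grad_comp_prodMk dg dΨ dβ, cross3_add_left, cross3_cross3, cross3_cross3]
    generalize grad Ψ x = p at *
    generalize grad α x = a at *
    generalize grad β x = b at *
    generalize fderiv ℝ f (Ψ x, α x) (1, 0) = f₁
    generalize fderiv ℝ g (Ψ x, β x) (1, 0) = g₁
    generalize f (Ψ x, α x) = f₀
    generalize g (Ψ x, β x) = g₀
    have hw0 (c : ℝ) : dot3 (c • p) (f₀ • a + g₀ • b) = 0 := by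
      simp only [dot3, Pi.add_apply, Pi.smul_apply, smul_eq_mul] at hα0 hβ0 ⊢
      linear_combination c * f₀ * hα0 + c * g₀ * hβ0
    rw [hw0, hw0]
    ext k
    simp only [dot3, Pi.add_apply, Pi.sub_apply, Pi.smul_apply, smul_eq_mul]
    ring
  refine ⟨main, fun x hx => ?_⟩
  rw [main x hx, cross3_smul_self]
end

section
/- Fix r₀ > 0 and ε > 0. On the open set Ω₀ = {(x,y,z) ∈ ℝ³ : r > 0}, where r = √(x²+y²) and φ is the azimuthal angle, define the vector field ξ_ε = ∇φ + ε e_x (where e_x = (1,0,0), since ∇(r cos φ) = ∇x = e_x) and the function Ψ_ε = (1/2)[(r e^{−εy} − r₀)² + z²]. Then ξ_ε is harmonic on Ω₀, i.e. ∇×ξ_ε = 0 and ∇·ξ_ε = 0, and ξ_ε·∇Ψ_ε = 0 on Ω₀. Consequently, for any continuously differentiable f : ℝ → ℝ, the vector field w = f(Ψ_ε) ξ_ε satisfies (∇×w)×w = −(1/2)(d(f²)/dΨ_ε)(Ψ_ε) · ((1−εy)² + ε²x²)/r² · ∇Ψ_ε and ∇·w = 0 on Ω₀. -/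
/-- The cylindrical radius `r = √(x² + y²)`. -/
noncomputable def cylR (p : Fin 3 → ℝ) : ℝ := Real.sqrt (p 0 ^ 2 + p 1 ^ 2)

theorem pd_of_hasFDerivAt {g : (Fin 3 → ℝ) → ℝ} {g' : (Fin 3 → ℝ) →L[ℝ] ℝ} {p : Fin 3 → ℝ}
    (hg : HasFDerivAt g g' p) (i : Fin 3) : pd i g p = g' (Pi.single i 1) := by
  rw [pd, hg.fderiv]

theorem pd_mul_s11 {g h : (Fin 3 → ℝ) → ℝ} {p : Fin 3 → ℝ} (hg : DifferentiableAt ℝ g p)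
    (hh : DifferentiableAt ℝ h p) (i : Fin 3) :
    pd i (fun q => g q * h q) p = g p * pd i h p + h p * pd i g p := by
  rw [pd_of_hasFDerivAt (hg.hasFDerivAt.fun_mul hh.hasFDerivAt)]
  simp [pd]

theorem grad_comp {f : ℝ → ℝ} {g : (Fin 3 → ℝ) → ℝ} {p : Fin 3 → ℝ}
    (hf : DifferentiableAt ℝ f (g p)) (hg : DifferentiableAt ℝ g p) :
    grad (fun q => f (g q)) p = deriv f (g p) • grad g p := by
  have h (i : Fin 3) : pd i (fun q => f (g q)) p = deriv f (g p) * pd i g p := by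
    have := hf.hasDerivAt.comp_hasFDerivAt p hg.hasFDerivAt
    rw [pd_of_hasFDerivAt (g := fun q => f (g q)) this]
    simp [pd]
  simp [grad, h]

theorem curl_smul {g : (Fin 3 → ℝ) → ℝ} {v : (Fin 3 → ℝ) → (Fin 3 → ℝ)} {p : Fin 3 → ℝ}
    (hg : DifferentiableAt ℝ g p) (hv : ∀ i, DifferentiableAt ℝ (fun q => v q i) p) :
    curl (fun q => g q • v q) p = cross3 (grad g p) (v p) + g p • curl v p := by
  ext i
  fin_cases i <;> simp [curl, cross3, grad, pd_mul_s11 hg (hv _)] <;> ring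

theorem div3_smul {g : (Fin 3 → ℝ) → ℝ} {v : (Fin 3 → ℝ) → (Fin 3 → ℝ)} {p : Fin 3 → ℝ}
    (hg : DifferentiableAt ℝ g p) (hv : ∀ i, DifferentiableAt ℝ (fun q => v q i) p) :
    div3 (fun q => g q • v q) p = dot3 (v p) (grad g p) + g p * div3 v p := by
  simp [div3, dot3, grad, pd_mul_s11 hg (hv _)]
  ring

theorem dot3_smul_right (c : ℝ) (u v : Fin 3 → ℝ) : dot3 u (c • v) = c * dot3 u v := by
  simp [dot3]
  ring

theorem cross3_cross3_smul (a b : ℝ) (u v : Fin 3 → ℝ) :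
    cross3 (cross3 (a • u) v) (b • v) = (a * b) • (dot3 v u • v - dot3 v v • u) := by
  ext i
  fin_cases i <;> simp [cross3, dot3] <;> ring

theorem cylR_pos_iff {p : Fin 3 → ℝ} : 0 < cylR p ↔ 0 < p 0 ^ 2 + p 1 ^ 2 := Real.sqrt_pos

theorem hasFDerivAt_coord (i : Fin 3) (p : Fin 3 → ℝ) :
    HasFDerivAt (fun q : Fin 3 → ℝ => q i) (ContinuousLinearMap.proj (R := ℝ) i) p :=
  (ContinuousLinearMap.proj (R := ℝ) (φ := fun _ : Fin 3 => ℝ) i).hasFDerivAt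

theorem hasFDerivAt_div {g h : (Fin 3 → ℝ) → ℝ} {g' h' : (Fin 3 → ℝ) →L[ℝ] ℝ} {p : Fin 3 → ℝ}
    (hg : HasFDerivAt g g' p) (hh : HasFDerivAt h h' p) (hp : h p ≠ 0) :
    HasFDerivAt (fun q => g q / h q) ((h p)⁻¹ • g' - (g p / h p ^ 2) • h') p := by
  simp_rw [div_eq_mul_inv]
  refine (hg.fun_mul ((hasDerivAt_inv hp).comp_hasFDerivAt p hh)).congr_fderiv ?_
  ext v
  simp
  ring

theorem hasFDerivAt_sq_add_sq (p : Fin 3 → ℝ) :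
    HasFDerivAt (fun q : Fin 3 → ℝ => q 0 ^ 2 + q 1 ^ 2)
      ((2 * p 0) • ContinuousLinearMap.proj (R := ℝ) 0
        + (2 * p 1) • ContinuousLinearMap.proj (R := ℝ) 1) p := by
  refine (((hasFDerivAt_coord 0 p).pow 2).fun_add
    ((hasFDerivAt_coord 1 p).pow 2)).congr_fderiv ?_
  simp

/-- The field `∇φ + ε e_x`. -/
noncomputable def harmonicField (ε : ℝ) (p : Fin 3 → ℝ) : Fin 3 → ℝ :=
  ![-(p 1) / (p 0 ^ 2 + p 1 ^ 2) + ε, p 0 / (p 0 ^ 2 + p 1 ^ 2), 0]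

/-- The function `(1/2)[(r e^{−εy} − r₀)² + z²]`. -/
noncomputable def fluxFunction (r₀ ε : ℝ) (p : Fin 3 → ℝ) : ℝ :=
  (1/2) * ((cylR p * Real.exp (-ε * p 1) - r₀) ^ 2 + p 2 ^ 2)

section

variable {p : Fin 3 → ℝ} (r₀ ε : ℝ)

theorem hasFDerivAt_harmonicField_zero (hp : 0 < cylR p) :
    HasFDerivAt (fun q => harmonicField ε q 0)
      ((2 * p 0 * p 1 / (p 0 ^ 2 + p 1 ^ 2) ^ 2) • ContinuousLinearMap.proj (R := ℝ) 0
        + ((p 1 ^ 2 - p 0 ^ 2) / (p 0 ^ 2 + p 1 ^ 2) ^ 2) •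
          ContinuousLinearMap.proj (R := ℝ) 1) p := by
  have hs := (cylR_pos_iff.1 hp).ne'
  refine ((hasFDerivAt_div (hasFDerivAt_coord 1 p).fun_neg (hasFDerivAt_sq_add_sq p) hs).add_const ε).congr_fderiv ?_
  ext v
  simp
  field_simp
  ring

theorem hasFDerivAt_harmonicField_one (hp : 0 < cylR p) :
    HasFDerivAt (fun q => harmonicField ε q 1)
      (((p 1 ^ 2 - p 0 ^ 2) / (p 0 ^ 2 + p 1 ^ 2) ^ 2) • ContinuousLinearMap.proj (R := ℝ) 0
        - (2 * p 0 * p 1 / (p 0 ^ 2 + p 1 ^ 2) ^ 2) •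
          ContinuousLinearMap.proj (R := ℝ) 1) p := by
  have hs := (cylR_pos_iff.1 hp).ne'
  refine (hasFDerivAt_div (hasFDerivAt_coord 0 p) (hasFDerivAt_sq_add_sq p) hs).congr_fderiv ?_
  ext v
  simp
  field_simp
  ring

theorem hasFDerivAt_harmonicField_two :
    HasFDerivAt (fun q => harmonicField ε q 2) (0 : (Fin 3 → ℝ) →L[ℝ] ℝ) p :=
  hasFDerivAt_const 0 p

theorem differentiableAt_harmonicField (hp : 0 < cylR p) (i : Fin 3) :
    DifferentiableAt ℝ (fun q => harmonicField ε q i) p := by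
  fin_cases i
  · exact (hasFDerivAt_harmonicField_zero ε hp).differentiableAt
  · exact (hasFDerivAt_harmonicField_one ε hp).differentiableAt
  · exact (hasFDerivAt_harmonicField_two ε).differentiableAt

theorem curl_harmonicField (hp : 0 < cylR p) : curl (harmonicField ε) p = 0 := by
  ext i
  fin_cases i <;>
    simp [curl, pd_of_hasFDerivAt (hasFDerivAt_harmonicField_zero ε hp),
      pd_of_hasFDerivAt (hasFDerivAt_harmonicField_one ε hp),
      pd_of_hasFDerivAt (hasFDerivAt_harmonicField_two ε)]

theorem div3_harmonicField (hp : 0 < cylR p) : div3 (harmonicField ε) p = 0 := by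
  simp [div3, pd_of_hasFDerivAt (hasFDerivAt_harmonicField_zero ε hp),
    pd_of_hasFDerivAt (hasFDerivAt_harmonicField_one ε hp),
    pd_of_hasFDerivAt (hasFDerivAt_harmonicField_two ε)]

theorem dot3_harmonicField_self (hp : 0 < cylR p) :
    dot3 (harmonicField ε p) (harmonicField ε p) =
      ((1 - ε * p 1) ^ 2 + ε ^ 2 * p 0 ^ 2) / (p 0 ^ 2 + p 1 ^ 2) := by
  have hs := (cylR_pos_iff.1 hp).ne'
  simp [dot3, harmonicField]
  field_simp
  ring

theorem hasFDerivAt_cylR (hp : 0 < cylR p) :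
    HasFDerivAt cylR ((p 0 / cylR p) • ContinuousLinearMap.proj (R := ℝ) 0
      + (p 1 / cylR p) • ContinuousLinearMap.proj (R := ℝ) 1) p := by
  refine ((hasFDerivAt_sq_add_sq p).sqrt (cylR_pos_iff.1 hp).ne').congr_fderiv ?_
  rw [← cylR]
  ext v
  simp
  field_simp

theorem hasFDerivAt_fluxFunction (hp : 0 < cylR p) :
    HasFDerivAt (fluxFunction r₀ ε)
      (((cylR p * Real.exp (-ε * p 1) - r₀) * Real.exp (-ε * p 1)) •
        ((p 0 / cylR p) • ContinuousLinearMap.proj (R := ℝ) 0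
          + (p 1 / cylR p - ε * cylR p) • ContinuousLinearMap.proj (R := ℝ) 1)
        + p 2 • ContinuousLinearMap.proj (R := ℝ) 2) p := by
  have he := ((hasFDerivAt_coord 1 p).const_mul (-ε)).exp
  have hz := (hasFDerivAt_coord 2 p).pow 2
  refine ((((((hasFDerivAt_cylR hp).fun_mul he).sub_const r₀).pow 2).fun_add hz).const_mul
    (1 / 2)).congr_fderiv ?_
  ext v
  simp
  ring

theorem dot3_harmonicField_grad_fluxFunction (hp : 0 < cylR p) :
    dot3 (harmonicField ε p) (grad (fluxFunction r₀ ε) p) = 0 := by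
  have hsq : p 0 ^ 2 + p 1 ^ 2 = cylR p ^ 2 := (Real.sq_sqrt (cylR_pos_iff.1 hp).le).symm
  have hr := hp.ne'
  simp [dot3, grad, pd_of_hasFDerivAt (hasFDerivAt_fluxFunction r₀ ε hp), harmonicField, hsq]
  field_simp
  ring

end

/-- on `Ω₀ = {r > 0}` the vector field `ξ_ε = ∇φ + ε e_x` is harmonic and tangent
to the level sets of `Ψ_ε = (1/2)[(r e^{−εy} − r₀)² + z²]`; consequently `w = f(Ψ_ε) ξ_ε`
satisfies `(∇×w)×w = −(1/2)(f²)'(Ψ_ε)·((1−εy)² + ε²x²)/r² · ∇Ψ_ε` and `∇·w = 0`. -/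
theorem harmonic_asymmetric_example
    (r₀ ε : ℝ) (hr₀ : 0 < r₀) (hε : 0 < ε)
    (ξ : (Fin 3 → ℝ) → (Fin 3 → ℝ))
    (hξ : ∀ p : Fin 3 → ℝ, ξ p =
      ![-(p 1) / (p 0 ^ 2 + p 1 ^ 2) + ε, p 0 / (p 0 ^ 2 + p 1 ^ 2), 0])
    (Ψ : (Fin 3 → ℝ) → ℝ)
    (hΨ : ∀ p : Fin 3 → ℝ, Ψ p =
      (1/2) * ((cylR p * Real.exp (-ε * p 1) - r₀) ^ 2 + p 2 ^ 2)) :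
    (∀ p : Fin 3 → ℝ, 0 < cylR p → curl ξ p = 0) ∧
    (∀ p : Fin 3 → ℝ, 0 < cylR p → div3 ξ p = 0) ∧
    (∀ p : Fin 3 → ℝ, 0 < cylR p → dot3 (ξ p) (grad Ψ p) = 0) ∧
    (∀ f : ℝ → ℝ, ContDiff ℝ 1 f →
      ∀ w : (Fin 3 → ℝ) → (Fin 3 → ℝ), (∀ p, w p = f (Ψ p) • ξ p) →
      ∀ p : Fin 3 → ℝ, 0 < cylR p →
        cross3 (curl w p) (w p) =
          (-(1/2) * deriv (fun t => f t ^ 2) (Ψ p) *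
            (((1 - ε * p 1) ^ 2 + ε ^ 2 * p 0 ^ 2) / (p 0 ^ 2 + p 1 ^ 2))) • grad Ψ p ∧
        div3 w p = 0) := by
  obtain rfl : ξ = harmonicField ε := funext hξ
  obtain rfl : Ψ = fluxFunction r₀ ε := funext hΨ
  refine ⟨fun p => curl_harmonicField ε, fun p => div3_harmonicField ε,
    fun p => dot3_harmonicField_grad_fluxFunction r₀ ε, ?_⟩
  intro f hf w hw p hp
  obtain rfl := funext hw
  have hfd : Differentiable ℝ f := hf.differentiable one_ne_zero
  have hΨd := (hasFDerivAt_fluxFunction r₀ ε hp).differentiableAt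
  have hg : DifferentiableAt ℝ (fun q => f (fluxFunction r₀ ε q)) p := (hfd _).comp p hΨd
  have hξd := differentiableAt_harmonicField ε hp
  have horth := dot3_harmonicField_grad_fluxFunction r₀ ε hp
  constructor
  · have hsq : deriv (fun t => f t ^ 2) (fluxFunction r₀ ε p) =
        2 * f (fluxFunction r₀ ε p) * deriv f (fluxFunction r₀ ε p) := by
      simp [deriv_fun_pow (hfd _)]
    rw [curl_smul hg hξd, curl_harmonicField ε hp, smul_zero, add_zero, grad_comp (hfd _) hΨd,
      cross3_cross3_smul, horth, dot3_harmonicField_self ε hp, hsq]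
    module
  · rw [div3_smul hg hξd, div3_harmonicField ε hp, grad_comp (hfd _) hΨd, dot3_smul_right, horth]
    simp
end
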